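/- arXiv:1711.06155 — 2 statements merged into one kernel-verified Lean document; each statement's English description precedes it below -/
import Mathlib

section
/- Let G be an abelian group and n ≥ 1 an integer. If for every g ∈ G there exists a divisible subgroup K ≤ G such that g ∈ K + Tor_n(G), then G is n-bounded-divisible, i.e., G ≅ ℚ^{(λ_∞)} ⊕ ⨁_p ℤ(p^∞)^{(λ_p)} ⊕ ⨁_{p^m ∣ n} (ℤ/p^mℤ)^{(λ_{(p,m)})} for some cardinals λ_∞, λ_p, λ_{(p,m)} (p ranging over primes). -/
/-- A subgroup `K` of an abelian group is divisible if every element of `K` is an `m`-th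
multiple of an element of `K`, for every `m ≥ 1`. -/
def AddSubgroup.IsDivisible {G : Type*} [AddCommGroup G] (K : AddSubgroup G) : Prop :=
  ∀ a ∈ K, ∀ m : ℕ, 1 ≤ m → ∃ b ∈ K, m • b = a

/-- The Prüfer `p`-group `ℤ(p^∞)`, realized as the `p`-primary component of `ℚ/ℤ`:
the subgroup of elements killed by some power of `p`. -/
def pruferAddSubgroup (p : ℕ) :
    AddSubgroup (ℚ ⧸ AddSubgroup.zmultiples (1 : ℚ)) where
  carrier := {x | ∃ k : ℕ, p ^ k • x = 0}
  zero_mem' := ⟨0, smul_zero _⟩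
  add_mem' := by
    rintro x y ⟨k, hk⟩ ⟨m, hm⟩
    refine ⟨k + m, ?_⟩
    have hx : p ^ (k + m) • x = 0 := by rw [pow_add, mul_comm, mul_smul, hk, smul_zero]
    have hy : p ^ (k + m) • y = 0 := by rw [pow_add, mul_smul, hm, smul_zero]
    rw [smul_add, hx, hy, add_zero]
  neg_mem' := by
    rintro x ⟨k, hk⟩
    exact ⟨k, by rw [smul_neg, hk, neg_zero]⟩

/-- A set of elements of an abelian group is independent modulo `p` if the coefficients of every
vanishing integral combination of it are divisible by `p`. -/
def IndepModPrime {H : Type*} [AddCommGroup H] (p : ℕ) (B : Set H) : Prop :=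
  ∀ s : Finset H, (s : Set H) ⊆ B → ∀ a : H → ℤ, ∑ x ∈ s, a x • x = 0 → ∀ x ∈ s, (p : ℤ) ∣ a x

/-- A finite descending chain of subspaces has a linearly independent set adapted to it. -/
theorem exists_linearIndepOn_adapted {K V : Type*} [DivisionRing K] [AddCommGroup V] [Module K V]
    (S : ℕ → Submodule K V) (hS : Antitone S) (N : ℕ) (hN : S N = ⊥) :
    ∃ B ⊆ (S 0 : Set V), LinearIndepOn K id B ∧ ∀ k, S k ≤ Submodule.span K (B ∩ S k) := by
  have key : ∀ d ≤ N, ∃ B ⊆ (S (N - d) : Set V), LinearIndepOn K id B ∧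
      ∀ k, N - d ≤ k → S k ≤ Submodule.span K (B ∩ S k) := by
    intro d
    induction d with
    | zero =>
      refine fun _ ↦ ⟨∅, by simp, linearIndepOn_empty _ _, fun k hk ↦ ?_⟩
      exact ((hS hk).trans hN.le).trans bot_le
    | succ d ih =>
      intro hd
      obtain ⟨B, hBS, hB, hspan⟩ := ih (by omega)
      obtain ⟨B', hB'S, hBB', hspan', hB'⟩ := exists_linearIndepOn_extension (v := id) hB
        (hBS.trans (hS (show N - (d + 1) ≤ N - d by omega)))
      refine ⟨B', hB'S, hB', fun k hk ↦ ?_⟩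
      rcases hk.eq_or_lt with rfl | hk
      · rw [Set.inter_eq_left.mpr hB'S]
        simpa using hspan'
      · exact (hspan k (by omega)).trans
          (Submodule.span_mono (Set.inter_subset_inter_left _ hBB'))
  obtain ⟨B, hBS, hB, hspan⟩ := key N le_rfl
  simp only [Nat.sub_self] at hBS hspan
  exact ⟨B, hBS, hB, fun k ↦ hspan k (Nat.zero_le k)⟩

theorem exists_indepModPrime_adapted_of_zmod {V : Type*} [AddCommGroup V] {p : ℕ} [Fact p.Prime]
    [Module (ZMod p) V] (S : ℕ → AddSubgroup V) (hS : Antitone S) (N : ℕ) (hN : S N = ⊥) :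
    ∃ B ⊆ (S 0 : Set V), IndepModPrime p B ∧ ∀ k, S k ≤ AddSubgroup.closure (B ∩ S k) := by
  let S' : ℕ → Submodule (ZMod p) V := fun k ↦ AddSubgroup.toZModSubmodule p (S k)
  have hS' : Antitone S' := by
    intro i j h x hx
    exact hS h hx
  obtain ⟨B, hB0, hB, hspan⟩ := exists_linearIndepOn_adapted S' hS' N (by simp [S', hN])
  refine ⟨B, hB0, fun s hs a ha x hx ↦ ?_, fun k x hx ↦ ?_⟩
  · have := linearIndepOn_iff'.mp hB s (fun x ↦ (a x : ZMod p)) hs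
      (by simpa [Int.cast_smul_eq_zsmul] using ha) x hx
    exact (ZMod.intCast_zmod_eq_zero_iff_dvd _ _).mp this
  · have h1 : Submodule.span (ZMod p) (B ∩ (S k : Set V)) ≤
        AddSubgroup.toZModSubmodule p (AddSubgroup.closure (B ∩ S k)) :=
      Submodule.span_le.mpr AddSubgroup.subset_closure
    exact h1 (hspan k hx)

theorem exists_indepModPrime_adapted {H : Type*} [AddCommGroup H] {p : ℕ} (hp : p.Prime)
    (S : ℕ → AddSubgroup H) (hS : Antitone S) (hS0 : ∀ x ∈ S 0, p • x = 0)
    (N : ℕ) (hN : S N = ⊥) :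
    ∃ B ⊆ (S 0 : Set H), IndepModPrime p B ∧ ∀ k, S k ≤ AddSubgroup.closure (B ∩ S k) := by
  classical
  have : Fact p.Prime := ⟨hp⟩
  have : Module (ZMod p) (S 0) := AddCommGroup.zmodModule fun x ↦ Subtype.ext (hS0 x x.2)
  obtain ⟨B, -, hB, hspan⟩ := exists_indepModPrime_adapted_of_zmod (V := S 0) (p := p)
    (fun k ↦ (S k).addSubgroupOf (S 0)) (fun _ _ h ↦ AddSubgroup.comap_mono (hS h)) N (by simp [hN])
  refine ⟨(↑) '' B, by rintro _ ⟨x, -, rfl⟩; exact x.2, fun s hs a ha x hx ↦ ?_, fun k x hx ↦ ?_⟩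
  · have hs0 : ∀ x ∈ s, x ∈ S 0 := fun x hx ↦ by
      obtain ⟨y, -, rfl⟩ := hs hx
      exact y.2
    refine hB (s.subtype (· ∈ S 0)) (fun y hy ↦ ?_) (fun y ↦ a y) (Subtype.ext ?_) ⟨x, hs0 x hx⟩
      (by simpa using hx)
    · obtain ⟨z, hz, hzy⟩ := hs (by simpa using hy)
      rwa [← Subtype.ext hzy]
    · rw [AddSubgroup.val_finsetSum, ZeroMemClass.coe_zero, ← ha,
        ← Finset.sum_subtype_of_mem (fun x ↦ a x • x) hs0]
      rfl
  · have h := AddSubgroup.mem_map_of_mem (S 0).subtype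
      (hspan k (show (⟨x, hS k.zero_le hx⟩ : S 0) ∈ _ from hx))
    rw [AddMonoidHom.map_closure] at h
    refine AddSubgroup.closure_mono ?_ h
    rintro _ ⟨y, ⟨hy, hyk⟩, rfl⟩
    exact ⟨⟨y, hy, rfl⟩, hyk⟩

theorem DFinsupp.exists_nsmul_eq_zero {I : Type*} {A : I → Type*} [∀ i, AddCommGroup (A i)]
    (hA : ∀ i, ∀ x : A i, ∃ k : ℕ, 0 < k ∧ k • x = 0) (x : Π₀ i, A i) :
    ∃ k : ℕ, 0 < k ∧ k • x = 0 := by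
  classical
  induction x using DFinsupp.induction with
  | h0 => exact ⟨1, one_pos, smul_zero _⟩
  | ha i b f _ _ ih =>
    obtain ⟨k, hk, hkf⟩ := ih
    obtain ⟨m, hm, hmb⟩ := hA i b
    refine ⟨k * m, Nat.mul_pos hk hm, ?_⟩
    rw [smul_add, mul_comm k m, mul_smul m k f, hkf, mul_comm m k, mul_smul k m,
      ← DFinsupp.single_smul, hmb]
    simp

/-- A homomorphism from a torsion group is injective if it is so on elements of prime order. -/
theorem AddMonoidHom.injective_of_prime_torsion {M H : Type*} [AddCommGroup M] [AddCommGroup H]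
    (f : M →+ H) (hM : ∀ x : M, ∃ k : ℕ, 0 < k ∧ k • x = 0)
    (hf : ∀ p : ℕ, p.Prime → ∀ x : M, p • x = 0 → f x = 0 → x = 0) : Function.Injective f := by
  rw [injective_iff_map_eq_zero]
  intro x hx
  obtain ⟨k, hk, hkx⟩ := hM x
  induction k using Nat.recOnMul generalizing x with
  | zero => omega
  | one => simpa using hkx
  | prime p hp => exact hf p hp x hkx hx
  | mul a b iha ihb =>
    have h : b • x = 0 := iha (b • x) (by rw [map_nsmul, hx, smul_zero])
      (Nat.pos_of_mul_pos_right hk) (by rwa [smul_smul])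
    exact ihb x hx (Nat.pos_of_mul_pos_left hk) h

/-- A homomorphism to a torsion group is surjective if, for every prime `p`, it hits the elements
of order `p` in such a way that `p`-heights are attained by preimages. -/
theorem AddMonoidHom.surjective_of_prime_torsion {M H : Type*} [AddCommGroup M] [AddCommGroup H]
    (f : M →+ H) (hH : ∀ x : H, ∃ k : ℕ, 0 < k ∧ k • x = 0)
    (hf : ∀ p : ℕ, p.Prime → ∀ (j : ℕ) (y : H), p • p ^ j • y = 0 →
      ∃ x, p ^ j • f x = p ^ j • y) : Function.Surjective f := by
  intro y
  obtain ⟨k, hk, hky⟩ := hH y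
  induction k using Nat.recOnPosPrimePosCoprime generalizing y with
  | zero => omega
  | one => exact ⟨0, by simpa using hky.symm⟩
  | prime_pow p j hp hj =>
    clear hk hj
    induction j generalizing y with
    | zero => exact ⟨0, by simpa using hky.symm⟩
    | succ j ih =>
      obtain ⟨x, hx⟩ := hf p hp j y (by rwa [smul_smul, ← pow_succ'])
      obtain ⟨z, hz⟩ := ih (y - f x) (by rw [smul_sub, hx, sub_self])
      exact ⟨z + x, by rw [map_add, hz, sub_add_cancel]⟩
  | coprime a b ha hb hab iha ihb =>
    obtain ⟨u, hu⟩ := iha (b • y) (by omega) (by rwa [smul_smul])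
    obtain ⟨v, hv⟩ := ihb (a • y) (by omega) (by rwa [smul_smul, mul_comm])
    have h := Nat.gcd_eq_gcd_ab a b
    rw [hab.gcd_eq_one, Nat.cast_one] at h
    refine ⟨Nat.gcdA a b • v + Nat.gcdB a b • u, ?_⟩
    rw [map_add, map_zsmul, map_zsmul, hu, hv, ← natCast_zsmul, ← natCast_zsmul, smul_smul,
      smul_smul, ← add_smul, mul_comm _ (a : ℤ), mul_comm _ (b : ℤ), ← h, one_smul]

/-- A sum of homomorphisms is injective if the images of the socle generators are independent. -/
theorem DFinsupp.sumAddHom_injective_of_indepModPrime {I H : Type*} {A : I → Type*} [DecidableEq I]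
    [∀ i, AddCommGroup (A i)] [AddCommGroup H] (P : I → ℕ) (s : ∀ i, A i) (f : ∀ i, A i →+ H)
    (hA : ∀ i, ∀ x : A i, ∃ k : ℕ, 0 < k ∧ k • x = 0) (hsP : ∀ i, P i • s i = 0)
    (hs : ∀ i, ∀ p : ℕ, p.Prime → ∀ x : A i, p • x = 0 → x ≠ 0 → p = P i ∧ ∃ a : ℤ, x = a • s i)
    (B : ℕ → Set H) (hB : ∀ p, p.Prime → IndepModPrime p (B p)) (hfB : ∀ i, f i (s i) ∈ B (P i))
    (hinj : ∀ i j, P i = P j → f i (s i) = f j (s j) → i = j) :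
    Function.Injective (DFinsupp.sumAddHom f) := by
  classical
  refine AddMonoidHom.injective_of_prime_torsion _ (DFinsupp.exists_nsmul_eq_zero hA) ?_
  intro p hp x hpx hfx
  have hx : ∀ i, p • x i = 0 := fun i ↦ by rw [← DFinsupp.smul_apply, hpx, DFinsupp.zero_apply]
  have hP : ∀ i ∈ x.support, p = P i := fun i hi ↦
    (hs i p hp (x i) (hx i) (DFinsupp.mem_support_iff.mp hi)).1
  have hxs : ∀ i, ∃ a : ℤ, x i = a • s i := fun i ↦ by
    by_cases h : x i = 0
    · exact ⟨0, by simp [h]⟩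
    · exact (hs i p hp (x i) (hx i) h).2
  choose a ha using hxs
  by_contra hne
  obtain ⟨i, hi⟩ : ∃ i, x i ≠ 0 := by
    by_contra! h
    exact hne (DFinsupp.ext h)
  have : Nonempty I := ⟨i⟩
  let v : I → H := fun i ↦ f i (s i)
  have hv : Set.InjOn v x.support := fun j hj k hk h ↦
    hinj j k ((hP j hj).symm.trans (hP k hk)) h
  let g : H → I := Function.invFunOn v x.support
  have hg : ∀ j ∈ x.support, g (v j) = j := fun j hj ↦ hv.leftInvOn_invFunOn hj
  have hi' : i ∈ x.support := DFinsupp.mem_support_iff.mpr hi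
  have hdvd := hB p hp (x.support.image v) (by
    intro y hy
    obtain ⟨j, hj, rfl⟩ := Finset.mem_image.mp (Finset.mem_coe.mp hy)
    rw [hP j hj]
    exact hfB j) (fun y ↦ a (g y)) (by
    rw [Finset.sum_image hv, ← hfx, DFinsupp.sumAddHom_apply, DFinsupp.sum]
    refine Finset.sum_congr rfl fun j hj ↦ ?_
    rw [hg j hj, ← map_zsmul, ← ha]) (v i) (Finset.mem_image_of_mem v hi')
  rw [hg i hi'] at hdvd
  obtain ⟨c, hc⟩ := hdvd
  apply hi
  rw [ha i, hc, mul_comm, mul_smul, natCast_zsmul, hP i hi', hsP, smul_zero]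

theorem exists_divisible_extension {A T : Type*} [AddCommGroup A] [AddCommGroup T]
    (hT : ∀ m : ℕ, 1 ≤ m → ∀ a : T, ∃ b, m • b = a) {C : Type*} [AddCommGroup C] (i : C →+ A)
    (hi : Function.Injective i) (g : C →+ T) : ∃ h : A →+ T, ∀ c, h (i c) = g c := by
  let _ : DivisibleBy T ℤ := divisibleByOfSMulRightSurj T ℤ fun {n} hn a ↦ by
    obtain ⟨b, hb⟩ := hT n.natAbs (Nat.one_le_iff_ne_zero.mpr (Int.natAbs_ne_zero.mpr hn)) a
    refine ⟨n.sign • b, ?_⟩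
    change n • n.sign • b = a
    rw [smul_smul, Int.mul_sign_self, natCast_zsmul, hb]
  obtain ⟨h, hh⟩ := (Module.Baer.of_divisible T).extension_property i.toIntLinearMap hi
    g.toIntLinearMap
  exact ⟨h.toAddMonoidHom, fun c ↦ LinearMap.congr_fun hh c⟩

theorem eq_zero_of_coprime_nsmul {A : Type*} [AddGroup A] {m n : ℕ} (h : m.Coprime n) {x : A}
    (hm : m • x = 0) (hn : n • x = 0) : x = 0 := by
  rw [← AddMonoid.addOrderOf_eq_one_iff]
  exact Nat.eq_one_of_dvd_coprimes h (addOrderOf_dvd_of_nsmul_eq_zero hm)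
    (addOrderOf_dvd_of_nsmul_eq_zero hn)

/-- The class of `1 / p`, which generates the socle of the Prüfer `p`-group. -/
def pruferSocleGenerator (p : ℕ) (hp : p ≠ 0) : pruferAddSubgroup p :=
  ⟨QuotientAddGroup.mk (1 / p : ℚ), 1, by
    rw [pow_one, ← QuotientAddGroup.mk_nsmul, QuotientAddGroup.eq_zero_iff]
    exact ⟨1, by simp [hp]⟩⟩

theorem nsmul_pruferSocleGenerator {p : ℕ} (hp : p ≠ 0) : p • pruferSocleGenerator p hp = 0 := by
  refine Subtype.ext ?_
  change p • (QuotientAddGroup.mk (1 / p : ℚ) : ℚ ⧸ AddSubgroup.zmultiples (1 : ℚ)) = 0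
  rw [← QuotientAddGroup.mk_nsmul, QuotientAddGroup.eq_zero_iff]
  exact ⟨1, by simp [hp]⟩

theorem dvd_of_zsmul_pruferSocleGenerator {p : ℕ} (hp : p ≠ 0) {a : ℤ}
    (ha : a • pruferSocleGenerator p hp = 0) : (p : ℤ) ∣ a := by
  have h : a • (QuotientAddGroup.mk (1 / p : ℚ) : ℚ ⧸ AddSubgroup.zmultiples (1 : ℚ)) = 0 :=
    congrArg Subtype.val ha
  rw [← QuotientAddGroup.mk_zsmul, QuotientAddGroup.eq_zero_iff] at h
  obtain ⟨c, hc⟩ := h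
  refine ⟨c, ?_⟩
  have hp' : (p : ℚ) ≠ 0 := Nat.cast_ne_zero.mpr hp
  simp only [zsmul_eq_mul, mul_one, one_div] at hc
  field_simp at hc
  rw [mul_comm]
  exact_mod_cast hc.symm

theorem exists_zsmul_pruferSocleGenerator {p : ℕ} (hp : p ≠ 0) (x : pruferAddSubgroup p)
    (hx : p • x = 0) : ∃ a : ℤ, x = a • pruferSocleGenerator p hp := by
  obtain ⟨x, hx'⟩ := x
  obtain ⟨r, rfl⟩ := QuotientAddGroup.mk_surjective x
  have h : p • (QuotientAddGroup.mk r : ℚ ⧸ AddSubgroup.zmultiples (1 : ℚ)) = 0 :=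
    congrArg Subtype.val hx
  rw [← QuotientAddGroup.mk_nsmul, QuotientAddGroup.eq_zero_iff] at h
  obtain ⟨a, ha⟩ := h
  refine ⟨a, Subtype.ext ?_⟩
  have hp' : (p : ℚ) ≠ 0 := Nat.cast_ne_zero.mpr hp
  have hr : r = a • (1 / p : ℚ) := by
    simp only [zsmul_eq_mul, mul_one, nsmul_eq_mul] at ha ⊢
    rw [ha]
    field_simp
  change QuotientAddGroup.mk r = a • QuotientAddGroup.mk (1 / p : ℚ)
  rw [hr, QuotientAddGroup.mk_zsmul]

theorem eq_zsmul_pruferSocleGenerator_of_prime {p q : ℕ} (hp : p.Prime) (hq : q.Prime)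
    {x : pruferAddSubgroup p} (hqx : q • x = 0) (hx : x ≠ 0) :
    q = p ∧ ∃ a : ℤ, x = a • pruferSocleGenerator p hp.ne_zero := by
  obtain rfl : q = p := by
    by_contra hne
    obtain ⟨k, hk⟩ := x.2
    exact hx (eq_zero_of_coprime_nsmul (Nat.Coprime.pow_right k
      ((Nat.coprime_primes hq hp).mpr hne)) hqx (Subtype.ext hk))
  exact ⟨rfl, exists_zsmul_pruferSocleGenerator _ x hqx⟩

theorem exists_pow_nsmul_eq_of_prufer {p : ℕ} (hp : p ≠ 0) (j : ℕ) (x : pruferAddSubgroup p) :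
    ∃ y, p ^ j • y = x := by
  obtain ⟨x, k, hk⟩ := x
  obtain ⟨r, rfl⟩ := QuotientAddGroup.mk_surjective x
  have hp' : (p : ℚ) ≠ 0 := Nat.cast_ne_zero.mpr hp
  have h : p ^ j • (QuotientAddGroup.mk (r / p ^ j) : ℚ ⧸ AddSubgroup.zmultiples (1 : ℚ)) =
      QuotientAddGroup.mk r := by
    rw [← QuotientAddGroup.mk_nsmul, nsmul_eq_mul, Nat.cast_pow,
      mul_div_cancel₀ _ (pow_ne_zero j hp')]
  exact ⟨⟨QuotientAddGroup.mk (r / p ^ j), k + j, by rw [pow_add, mul_smul, h, hk]⟩,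
    Subtype.ext h⟩

theorem exists_pruferHom {T : Type*} [AddCommGroup T]
    (hT : ∀ m : ℕ, 1 ≤ m → ∀ a : T, ∃ b, m • b = a) {p : ℕ} (hp : p ≠ 0) (b : T)
    (hb : p • b = 0) : ∃ f : pruferAddSubgroup p →+ T, f (pruferSocleGenerator p hp) = b := by
  obtain ⟨h, hh⟩ := exists_divisible_extension hT
    (ZMod.lift p ⟨zmultiplesHom _ (pruferSocleGenerator p hp), by
      simpa using nsmul_pruferSocleGenerator hp⟩)
    ((ZMod.lift_injective _).mpr fun a ha ↦
      (ZMod.intCast_zmod_eq_zero_iff_dvd _ _).mpr (dvd_of_zsmul_pruferSocleGenerator hp ha))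
    (ZMod.lift p ⟨zmultiplesHom _ b, by simpa using hb⟩)
  have h1 := hh ((1 : ℤ) : ZMod p)
  rw [ZMod.lift_coe, ZMod.lift_coe] at h1
  exact ⟨h, by simpa using h1⟩

/-- Group the summands of a direct sum over a sigma type by their first index. -/
noncomputable def DFinsupp.sigmaAddEquivFinsupp {Q : Type*} (ι : Q → Type*) (A : Q → Type*)
    [∀ q, AddCommGroup (A q)] :
    (Π₀ i : (q : Q) × ι q, A i.1) ≃+ Π₀ q, ι q →₀ A q := by
  classical
  exact (DFinsupp.sigmaCurryLEquiv (R := ℕ) (M := fun q (_ : ι q) ↦ A q)).toAddEquiv.trans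
    (DFinsupp.mapRange.addEquiv fun _ ↦ finsuppAddEquivDFinsupp.symm)

theorem exists_addEquiv_prufer {T : Type*} [AddCommGroup T]
    (hT : ∀ m : ℕ, 1 ≤ m → ∀ a : T, ∃ b, m • b = a)
    (htors : ∀ x : T, ∃ k : ℕ, 0 < k ∧ k • x = 0) :
    ∃ B : ℕ → Set T, Nonempty (T ≃+ Π₀ p : {p : ℕ // p.Prime}, B p →₀ pruferAddSubgroup p) := by
  classical
  have hex : ∀ p : ℕ, ∃ B : Set T, p.Prime → IndepModPrime p B ∧ (∀ b ∈ B, p • b = 0) ∧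
      ∀ y : T, p • y = 0 → y ∈ AddSubgroup.closure B := fun p ↦ by
    by_cases hp : p.Prime
    · let S : ℕ → AddSubgroup T := fun k ↦ if k = 0 then (nsmulAddMonoidHom p).ker else ⊥
      have hS : Antitone S := antitone_nat_of_succ_le fun k ↦ by simp [S]
      obtain ⟨B, hB0, hB, hcl⟩ := exists_indepModPrime_adapted hp S hS
        (fun x hx ↦ by simpa [S] using hx) 1 (by simp [S])
      refine ⟨B, fun _ ↦ ⟨hB, fun b hb ↦ by simpa [S] using hB0 hb, fun y hy ↦ ?_⟩⟩
      exact AddSubgroup.closure_mono Set.inter_subset_left (hcl 0 (by simpa [S] using hy))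
    · exact ⟨∅, fun h ↦ absurd h hp⟩
  choose B hB using hex
  refine ⟨B, ?_⟩
  let I := (p : {p : ℕ // p.Prime}) × B p
  have hf : ∀ i : I, ∃ f : pruferAddSubgroup i.1 →+ T,
      f (pruferSocleGenerator i.1 i.1.2.ne_zero) = i.2 := fun i ↦
    exists_pruferHom hT i.1.2.ne_zero _ ((hB i.1 i.1.2).2.1 _ i.2.2)
  choose f hf using hf
  have hinj : Function.Injective (DFinsupp.sumAddHom f) := by
    refine DFinsupp.sumAddHom_injective_of_indepModPrime (fun i : I ↦ i.1.1)
      (fun i ↦ pruferSocleGenerator i.1 i.1.2.ne_zero) f ?_ ?_ ?_ B (fun p hp ↦ (hB p hp).1) ?_ ?_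
    · rintro ⟨p, b⟩ ⟨x, k, hk⟩
      exact ⟨p ^ k, pow_pos p.2.pos k, Subtype.ext hk⟩
    · exact fun i ↦ nsmul_pruferSocleGenerator _
    · exact fun i q hq x ↦ eq_zsmul_pruferSocleGenerator_of_prime i.1.2 hq
    · exact fun i ↦ by rw [hf]; exact i.2.2
    · rintro ⟨⟨p, hp⟩, b⟩ ⟨⟨q, hq⟩, c⟩ (rfl : p = q) h
      rw [hf, hf] at h
      obtain rfl : b = c := Subtype.ext h
      rfl
  have hsurj : Function.Surjective (DFinsupp.sumAddHom f) := by
    refine AddMonoidHom.surjective_of_prime_torsion _ htors fun p hp j y hy ↦ ?_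
    have hle : AddSubgroup.closure (B p) ≤
        ((nsmulAddMonoidHom (p ^ j)).comp (DFinsupp.sumAddHom f)).range := by
      refine (AddSubgroup.closure_le _).mpr fun b hb ↦ ?_
      obtain ⟨w, hw⟩ := exists_pow_nsmul_eq_of_prufer hp.ne_zero j (pruferSocleGenerator p hp.ne_zero)
      refine ⟨DFinsupp.single (⟨⟨p, hp⟩, ⟨b, hb⟩⟩ : I) w, ?_⟩
      rw [AddMonoidHom.comp_apply, DFinsupp.sumAddHom_single, nsmulAddMonoidHom_apply,
        ← map_nsmul, hw]
      exact hf ⟨⟨p, hp⟩, ⟨b, hb⟩⟩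
    exact hle ((hB p hp).2.2 _ hy)
  exact ⟨(AddEquiv.ofBijective _ ⟨hinj, hsurj⟩).symm.trans
    (DFinsupp.sigmaAddEquivFinsupp _ fun p : {p : ℕ // p.Prime} ↦ pruferAddSubgroup p)⟩

/-- The elements of order dividing `p` and of `p`-height at least `k`. -/
def heightSocle (H : Type*) [AddCommGroup H] (p k : ℕ) : AddSubgroup H :=
  (nsmulAddMonoidHom (α := H) p).ker ⊓ (nsmulAddMonoidHom (α := H) (p ^ k)).range

theorem mem_heightSocle {H : Type*} [AddCommGroup H] {p k : ℕ} {x : H} :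
    x ∈ heightSocle H p k ↔ p • x = 0 ∧ ∃ z, p ^ k • z = x := Iff.rfl

theorem heightSocle_antitone (H : Type*) [AddCommGroup H] (p : ℕ) :
    Antitone (heightSocle H p) := by
  intro j k hjk x hx
  obtain ⟨hx, z, rfl⟩ := hx
  refine ⟨hx, p ^ (k - j) • z, ?_⟩
  simp only [nsmulAddMonoidHom_apply]
  rw [smul_smul, ← pow_add, Nat.add_sub_cancel' hjk]

theorem heightSocle_eq_bot {H : Type*} [AddCommGroup H] {n p k : ℕ} (hp : p.Prime)
    (hn : ∀ x : H, n • x = 0) (hk : ¬ p ^ (k + 1) ∣ n) : heightSocle H p k = ⊥ := by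
  refine (AddSubgroup.eq_bot_iff_forall _).mpr fun x hx ↦ ?_
  obtain ⟨hx, z, rfl⟩ := mem_heightSocle.mp hx
  obtain ⟨j, hj, hjz⟩ := (Nat.dvd_prime_pow hp).mp
    (addOrderOf_dvd_of_nsmul_eq_zero (n := p ^ (k + 1)) (x := z) (by
      rwa [pow_succ', mul_smul]))
  have hjn : p ^ j ∣ n := hjz ▸ addOrderOf_dvd_of_nsmul_eq_zero (hn z)
  have hjk : j ≤ k := by
    by_contra h
    exact hk ((pow_dvd_pow p (by omega)).trans hjn)
  exact addOrderOf_dvd_iff_nsmul_eq_zero.mp (hjz ▸ pow_dvd_pow p hjk)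

theorem ZMod.exists_zsmul_of_prime_pow {p m : ℕ} (hp : p.Prime) (hm : 1 ≤ m) (x : ZMod (p ^ m))
    (hx : p • x = 0) : ∃ a : ℤ, x = a • (p ^ (m - 1) : ZMod (p ^ m)) := by
  obtain ⟨c, rfl⟩ := ZMod.intCast_surjective x
  have h : ((p * c : ℤ) : ZMod (p ^ m)) = 0 := by simpa using hx
  rw [ZMod.intCast_zmod_eq_zero_iff_dvd] at h
  obtain ⟨m, rfl⟩ := Nat.exists_eq_add_of_le' hm
  rw [Nat.cast_pow, pow_succ'] at h
  obtain ⟨a, rfl⟩ := (mul_dvd_mul_iff_left (by exact_mod_cast hp.ne_zero)).mp h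
  exact ⟨a, by simp [mul_comm]⟩

/-- An abelian group of bounded exponent is a direct sum of cyclic groups of prime power order. -/
theorem exists_addEquiv_zmod {H : Type*} [AddCommGroup H] {n : ℕ} (hn : 1 ≤ n)
    (hH : ∀ x : H, n • x = 0) :
    ∃ C : ℕ → ℕ → Set H, Nonempty (H ≃+
      Π₀ q : {q : ℕ × ℕ // q.1.Prime ∧ 1 ≤ q.2 ∧ q.1 ^ q.2 ∣ n},
        C q.1.1 q.1.2 →₀ ZMod (q.1.1 ^ q.1.2)) := by
  classical
  have hbot : ∀ p : ℕ, p.Prime → heightSocle H p n = ⊥ := fun p hp ↦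
    heightSocle_eq_bot hp hH fun h ↦
      absurd (Nat.le_of_dvd hn h) (Nat.lt_of_succ_lt (Nat.lt_pow_self hp.one_lt)).not_ge
  have hex : ∀ p : ℕ, ∃ B : Set H, p.Prime → B ⊆ (heightSocle H p 0 : Set H) ∧ IndepModPrime p B ∧
      ∀ k, heightSocle H p k ≤ AddSubgroup.closure (B ∩ heightSocle H p k) := fun p ↦ by
    by_cases hp : p.Prime
    · obtain ⟨B, hB⟩ := exists_indepModPrime_adapted hp (heightSocle H p)
        (heightSocle_antitone H p) (fun x hx ↦ hx.1) n (hbot p hp)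
      exact ⟨B, fun _ ↦ hB⟩
    · exact ⟨∅, fun h ↦ absurd h hp⟩
  choose B hB using hex
  let C : ℕ → ℕ → Set H := fun p m ↦
    {b | b ∈ B p ∧ b ∈ heightSocle H p (m - 1) ∧ b ∉ heightSocle H p m}
  refine ⟨C, ?_⟩
  let Q := {q : ℕ × ℕ // q.1.Prime ∧ 1 ≤ q.2 ∧ q.1 ^ q.2 ∣ n}
  let I := (q : Q) × C q.1.1 q.1.2
  have hf : ∀ i : I, ∃ f : ZMod (i.1.1.1 ^ i.1.1.2) →+ H,
      f (i.1.1.1 ^ (i.1.1.2 - 1) : ZMod (i.1.1.1 ^ i.1.1.2)) = i.2 := by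
    rintro ⟨⟨⟨p, m⟩, hp, hm, hpm⟩, b, hbB, ⟨hb, z, hz⟩, hbm⟩
    dsimp only at hp hm hpm hb hz ⊢
    rw [nsmulAddMonoidHom_apply] at hz
    have hb : p • b = 0 := hb
    have hz0 : zmultiplesHom H z (p ^ m : ℕ) = 0 := by
      rw [zmultiplesHom_apply, natCast_zsmul, ← Nat.sub_add_cancel hm, pow_succ', mul_smul, hz, hb]
    refine ⟨ZMod.lift (p ^ m) ⟨zmultiplesHom H z, hz0⟩, ?_⟩
    have h := ZMod.lift_coe (p ^ m) ⟨zmultiplesHom H z, hz0⟩ ((p ^ (m - 1) : ℕ) : ℤ)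
    refine Eq.trans (congrArg _ (by simp)) (h.trans ?_)
    change ((p ^ (m - 1) : ℕ) : ℤ) • z = b
    rw [natCast_zsmul, hz]
  choose f hf using hf
  have hinj : Function.Injective (DFinsupp.sumAddHom f) := by
    refine DFinsupp.sumAddHom_injective_of_indepModPrime (fun i : I ↦ i.1.1.1)
      (fun i ↦ (i.1.1.1 ^ (i.1.1.2 - 1) : ZMod (i.1.1.1 ^ i.1.1.2))) f ?_ ?_ ?_ B
      (fun p hp ↦ (hB p hp).2.1) ?_ ?_
    · exact fun i x ↦ ⟨_, pow_pos i.1.2.1.pos i.1.1.2, by simp⟩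
    · rintro ⟨⟨⟨p, m⟩, hp, hm, hpm⟩, b⟩
      dsimp only at hm ⊢
      rw [nsmul_eq_mul, ← pow_succ', Nat.sub_add_cancel hm]
      exact_mod_cast ZMod.natCast_self (p ^ m)
    · rintro ⟨⟨⟨p, m⟩, hp, hm, hpm⟩, b⟩ q hq x hqx hx
      dsimp only at hp hm hpm x hx hqx ⊢
      obtain rfl : q = p := by
        by_contra hne
        exact hx (eq_zero_of_coprime_nsmul (Nat.Coprime.pow_right m
          ((Nat.coprime_primes hq hp).mpr hne)) hqx (by simp))
      exact ⟨rfl, ZMod.exists_zsmul_of_prime_pow hp hm x hqx⟩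
    · exact fun i ↦ by rw [hf]; exact i.2.2.1
    · rintro ⟨⟨⟨p, m⟩, hp, hm, hpm⟩, b, hb⟩ ⟨⟨⟨q, l⟩, hq, hl, hql⟩, c, hc⟩ (rfl : p = q) h
      rw [hf, hf] at h
      obtain rfl : b = c := h
      obtain rfl : m = l := by
        by_contra hne
        rcases Nat.lt_or_gt_of_ne hne with h | h
        · exact hb.2.2 (heightSocle_antitone H p (Nat.le_sub_one_of_lt h) hc.2.1)
        · exact hc.2.2 (heightSocle_antitone H p (Nat.le_sub_one_of_lt h) hb.2.1)
      rfl
  have hsurj : Function.Surjective (DFinsupp.sumAddHom f) := by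
    refine AddMonoidHom.surjective_of_prime_torsion _ (fun x ↦ ⟨n, hn, hH x⟩) fun p hp j y hy ↦ ?_
    have hle : AddSubgroup.closure (B p ∩ heightSocle H p j) ≤
        ((nsmulAddMonoidHom (p ^ j)).comp (DFinsupp.sumAddHom f)).range := by
      refine (AddSubgroup.closure_le _).mpr fun b ⟨hb, hbj⟩ ↦ ?_
      by_cases hb0 : b = 0
      · exact hb0 ▸ zero_mem _
      have hlast : ∃ m, b ∉ heightSocle H p m := ⟨n, by rwa [hbot p hp]⟩
      let m := Nat.find hlast
      have hm : b ∉ heightSocle H p m := Nat.find_spec hlast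
      have hjm : j < m := by
        by_contra! h
        exact hm (heightSocle_antitone H p h hbj)
      have hm1 : b ∈ heightSocle H p (m - 1) :=
        not_not.mp (Nat.find_min hlast (Nat.sub_one_lt (by omega)))
      have hdvd : p ^ m ∣ n := by
        by_contra h
        rw [← Nat.sub_add_cancel (show 1 ≤ m by omega)] at h
        rw [heightSocle_eq_bot hp hH h] at hm1
        exact hb0 hm1
      let i : I := ⟨⟨(p, m), hp, by omega, hdvd⟩, ⟨b, hb, hm1, hm⟩⟩
      refine ⟨DFinsupp.single i (p ^ (m - 1 - j) : ZMod (p ^ m)), ?_⟩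
      rw [AddMonoidHom.comp_apply, DFinsupp.sumAddHom_single, nsmulAddMonoidHom_apply,
        ← map_nsmul]
      refine Eq.trans (congrArg (f i) ?_) (hf i)
      change p ^ j • (p ^ (m - 1 - j) : ZMod (p ^ m)) = (p ^ (m - 1) : ZMod (p ^ m))
      rw [nsmul_eq_mul, Nat.cast_pow, ← pow_add, Nat.add_sub_cancel' (by omega)]
    exact hle ((hB p hp).2.2 j ⟨hy, y, rfl⟩)
  exact ⟨(AddEquiv.ofBijective _ ⟨hinj, hsurj⟩).symm.trans
    (DFinsupp.sigmaAddEquivFinsupp (fun q : Q ↦ C q.1.1 q.1.2) fun q ↦ ZMod (q.1.1 ^ q.1.2))⟩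

/-- A divisible subgroup is a direct summand. -/
theorem AddSubgroup.IsDivisible.nonempty_addEquiv_prod {G : Type*} [AddCommGroup G]
    {K : AddSubgroup G} (hK : K.IsDivisible) : Nonempty (G ≃+ K × (G ⧸ K)) := by
  obtain ⟨r, hr⟩ := exists_divisible_extension (T := K) (fun m hm a ↦ by
    obtain ⟨b, hb, hba⟩ := hK a a.2 m hm
    exact ⟨⟨b, hb⟩, Subtype.ext hba⟩) K.subtype K.subtype_injective (AddMonoidHom.id K)
  refine ⟨AddEquiv.ofBijective (r.prod (QuotientAddGroup.mk' K)) ⟨?_, ?_⟩⟩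
  · rw [injective_iff_map_eq_zero]
    intro x hx
    obtain ⟨h1, h2⟩ := Prod.mk.inj hx
    have hxK : x ∈ K := (QuotientAddGroup.eq_zero_iff x).mp h2
    have h3 : (⟨x, hxK⟩ : K) = 0 := (hr ⟨x, hxK⟩).symm.trans h1
    exact congrArg Subtype.val h3
  · rintro ⟨k, y⟩
    obtain ⟨x, rfl⟩ := QuotientAddGroup.mk_surjective y
    refine ⟨x + (k - r x : K), Prod.ext ?_ ?_⟩
    · have h : r ((k - r x : K) : G) = k - r x := hr (k - r x)
      change r (x + (k - r x : K)) = k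
      rw [map_add, h, add_sub_cancel]
    · change ((x + (k - r x : K) : G) : G ⧸ K) = x
      rw [QuotientAddGroup.mk_add, (QuotientAddGroup.eq_zero_iff _).mpr (k - r x).2, add_zero]

theorem exists_addEquiv_rat {V : Type*} [AddCommGroup V] [IsAddTorsionFree V]
    (hV : ∀ m : ℕ, 1 ≤ m → ∀ a : V, ∃ b, m • b = a) :
    ∃ S : Set (DivisibleHull V), Nonempty (V ≃+ (S →₀ ℚ)) := by
  have hsurj : Function.Surjective (DivisibleHull.coeAddMonoidHom V) := fun x ↦ by
    induction x with | mk a s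
    obtain ⟨b, hb⟩ := hV s s.pos a
    exact ⟨b, DivisibleHull.mk_eq_mk_iff_smul_eq_smul.mpr (by simpa using hb)⟩
  exact ⟨_, ⟨(AddEquiv.ofBijective _ ⟨DivisibleHull.coe_injective, hsurj⟩).trans
    (Module.Basis.ofVectorSpace ℚ (DivisibleHull V)).repr.toAddEquiv⟩⟩

theorem AddCommGroup.torsion_isDivisible {D : Type*} [AddCommGroup D]
    (hD : ∀ m : ℕ, 1 ≤ m → ∀ a : D, ∃ b, m • b = a) : (AddCommGroup.torsion D).IsDivisible := by
  intro a ha m hm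
  obtain ⟨b, rfl⟩ := hD m hm a
  refine ⟨b, ?_, rfl⟩
  obtain ⟨k, hk, hkb⟩ := (isOfFinAddOrder_iff_nsmul_eq_zero).mp ha
  exact isOfFinAddOrder_iff_nsmul_eq_zero.mpr ⟨k * m, Nat.mul_pos hk hm, by rwa [mul_smul]⟩

theorem AddSubgroup.isDivisible_sSup {G : Type*} [AddCommGroup G] (s : Set (AddSubgroup G))
    (hs : ∀ K ∈ s, K.IsDivisible) : (sSup s).IsDivisible := by
  intro a ha m hm
  have hle : sSup s ≤ (sSup s).map (nsmulAddMonoidHom m) := sSup_le fun K hK x hx ↦ by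
    obtain ⟨b, hb, hbx⟩ := hs K hK x hx m hm
    exact ⟨b, le_sSup hK hb, hbx⟩
  exact hle ha

/-- The product of three additive isomorphisms. -/
def AddEquiv.prodCongr₃ {A B C A' B' C' : Type*} [Add A] [Add B] [Add C] [Add A'] [Add B'] [Add C']
    (e : A ≃+ A') (f : B ≃+ B') (g : C ≃+ C') : A × B × C ≃+ A' × B' × C' where
  __ := e.toEquiv.prodCongr (f.toEquiv.prodCongr g.toEquiv)
  map_add' x y := Prod.ext (map_add e x.1 y.1)
    (Prod.ext (map_add f x.2.1 y.2.1) (map_add g x.2.2 y.2.2))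

theorem Cardinal.exists_out_equiv.{u, v} (α : Type v) : ∃ c : Cardinal.{max u v}, Nonempty (c.out ≃ α) :=
  ⟨_, ⟨Cardinal.outMkEquiv.trans Equiv.ulift.{u}⟩⟩

/-- If every element of an abelian group `G` lies in `K + Tor_n(G)` for some divisible
subgroup `K ≤ G`, then `G` is `n`-bounded-divisible, i.e.
`G ≅ ℚ^{(λ_∞)} ⊕ ⨁_p ℤ(p^∞)^{(λ_p)} ⊕ ⨁_{p^m ∣ n} (ℤ/p^mℤ)^{(λ_{(p,m)})}`. -/
theorem bounded_divisible_of_divisible_mod_torsion {G : Type} [AddCommGroup G]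
    {n : ℕ} (hn : 1 ≤ n)
    (hyp : ∀ g : G, ∃ K : AddSubgroup G, K.IsDivisible ∧
      ∃ k ∈ K, ∃ t : G, n • t = 0 ∧ g = k + t) :
    ∃ (lamInf : Cardinal) (lamP : ℕ → Cardinal) (lamPM : ℕ → ℕ → Cardinal),
      Nonempty (G ≃+ (lamInf.out →₀ ℚ) ×
        (Π₀ p : {p : ℕ // p.Prime}, ((lamP p.1).out →₀ ↥(pruferAddSubgroup p.1))) ×
        (Π₀ q : {q : ℕ × ℕ // q.1.Prime ∧ 1 ≤ q.2 ∧ q.1 ^ q.2 ∣ n},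
          ((lamPM q.1.1 q.1.2).out →₀ ZMod (q.1.1 ^ q.1.2)))) := by
  let D : AddSubgroup G := sSup {K | K.IsDivisible}
  have hD : D.IsDivisible := AddSubgroup.isDivisible_sSup _ fun _ h ↦ h
  have hD' : ∀ m : ℕ, 1 ≤ m → ∀ a : D, ∃ b, m • b = a := fun m hm a ↦ by
    obtain ⟨b, hb, hba⟩ := hD a a.2 m hm
    exact ⟨⟨b, hb⟩, Subtype.ext hba⟩
  have hquot : ∀ x : G ⧸ D, n • x = 0 := fun x ↦ by
    obtain ⟨g, rfl⟩ := QuotientAddGroup.mk_surjective x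
    obtain ⟨K, hK, k, hk, t, ht, rfl⟩ := hyp g
    rw [← QuotientAddGroup.mk_nsmul, QuotientAddGroup.eq_zero_iff, smul_add, ht, add_zero]
    exact D.nsmul_mem (le_sSup (a := K) hK hk) n
  have hT := AddCommGroup.torsion_isDivisible hD'
  let T := AddCommGroup.torsion D
  obtain ⟨C, ⟨eC⟩⟩ := exists_addEquiv_zmod hn hquot
  obtain ⟨B, ⟨eB⟩⟩ := exists_addEquiv_prufer (T := T) (fun m hm a ↦ by
    obtain ⟨b, hb, hba⟩ := hT a a.2 m hm
    exact ⟨⟨b, hb⟩, Subtype.ext hba⟩) (fun x ↦ by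
    obtain ⟨k, hk, hkx⟩ := isOfFinAddOrder_iff_nsmul_eq_zero.mp x.2
    exact ⟨k, hk, Subtype.ext hkx⟩)
  obtain ⟨S, ⟨eS⟩⟩ := exists_addEquiv_rat (V := D ⧸ T) (fun m hm a ↦ by
    obtain ⟨d, rfl⟩ := QuotientAddGroup.mk_surjective a
    obtain ⟨b, rfl⟩ := hD' m hm d
    exact ⟨b, rfl⟩)
  obtain ⟨e1⟩ := hD.nonempty_addEquiv_prod
  obtain ⟨e2⟩ := hT.nonempty_addEquiv_prod
  obtain ⟨lamInf, ⟨e3⟩⟩ := Cardinal.exists_out_equiv S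
  choose lamP e4 using fun p ↦ Cardinal.exists_out_equiv (B p)
  choose lamPM e5 using fun p m ↦ Cardinal.exists_out_equiv (C p m)
  refine ⟨lamInf, lamP, lamPM, ⟨?_⟩⟩
  have e : G ≃+ ((D ⧸ T) × T) × (G ⧸ D) :=
    e1.trans ((e2.trans AddEquiv.prodComm).prodCongr (AddEquiv.refl _))
  have eB' : T ≃+ Π₀ p : {p : ℕ // p.Prime}, ((lamP p.1).out →₀ pruferAddSubgroup p.1) :=
    eB.trans (DFinsupp.mapRange.addEquiv fun p ↦ Finsupp.domCongr (e4 p).some.symm)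
  have eC' : (G ⧸ D) ≃+ Π₀ q : {q : ℕ × ℕ // q.1.Prime ∧ 1 ≤ q.2 ∧ q.1 ^ q.2 ∣ n},
      ((lamPM q.1.1 q.1.2).out →₀ ZMod (q.1.1 ^ q.1.2)) :=
    eC.trans (DFinsupp.mapRange.addEquiv fun q ↦
      Finsupp.domCongr (e5 q.1.1 q.1.2).some.symm)
  have eS' : (D ⧸ T) ≃+ (lamInf.out →₀ ℚ) := eS.trans (Finsupp.domCongr e3.symm)
  exact (e.trans AddEquiv.prodAssoc).trans (AddEquiv.prodCongr₃ eS' eB' eC')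
end

section
/- The direct sum of 2^{ℵ0} copies of ℚ admits a non-Archimedean Polish group topology, and for every prime p and every k ≥ 1, the direct sum of 2^{ℵ0} copies of ℤ/p^kℤ admits a non-Archimedean Polish group topology. -/
/-- An additive group admits a non-Archimedean Polish group topology if there is a topology
making it a nonarchimedean topological additive group whose underlying space is Polish. -/
def HasNonarchPolishAddGroupTopology (G : Type*) [AddGroup G] : Prop :=
  ∃ t : TopologicalSpace G, @NonarchimedeanAddGroup G _ t ∧ @PolishSpace G t

open Cardinal in
theorem mk_basis_pi_nat_eq_continuum {K : Type} [Field K] [Countable K] {B : Type}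
    (b : Module.Basis B K (ℕ → K)) : #B = 𝔠 := by
  rw [b.mk_eq_rank'', rank_fun_infinite, mk_arrow, lift_uzero, lift_uzero, mk_nat]
  refine le_antisymm ?_ ?_
  · calc #K ^ ℵ₀ ≤ ℵ₀ ^ ℵ₀ := power_le_power_right mk_le_aleph0
      _ = 𝔠 := aleph0_power_aleph0
  · calc 𝔠 = 2 ^ ℵ₀ := two_power_aleph0.symm
      _ ≤ #K ^ ℵ₀ := power_le_power_right (two_le_iff.2 ⟨0, 1, zero_ne_one⟩)

open Cardinal in
theorem nonempty_continuum_out_equiv_basis {K : Type} [Field K] [Countable K] {B : Type}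
    (b : Module.Basis B K (ℕ → K)) : Nonempty (continuum.{u}.out ≃ B) := by
  rw [← lift_mk_eq', mk_out, mk_basis_pi_nat_eq_continuum b, lift_continuum, lift_continuum]

theorem hasNonarchPolishAddGroupTopology_pi_nat (A : Type*) [AddGroup A] [Countable A] :
    HasNonarchPolishAddGroupTopology (ℕ → A) := by
  let _ : TopologicalSpace A := ⊥
  have : DiscreteTopology A := ⟨rfl⟩
  have : TopologicalSpace.IsCompletelyMetrizableSpace (ℕ → A) :=
    .pi_countable
  refine ⟨Pi.topologicalSpace, ⟨fun U hU => ?_⟩, inferInstance⟩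
  rw [nhds_pi, Filter.mem_pi] at hU
  obtain ⟨I, hI, t, ht, htU⟩ := hU
  refine ⟨⟨AddSubgroup.pi I fun _ => ⊥, isOpen_set_pi hI fun _ _ => isOpen_discrete _⟩, ?_⟩
  refine fun x hx => htU fun i hi => ?_
  have hxi : x i = 0 := hx i hi
  exact hxi ▸ mem_of_mem_nhds (ht i)

theorem HasNonarchPolishAddGroupTopology.of_addEquiv {G H : Type*} [AddGroup G] [AddGroup H]
    (h : HasNonarchPolishAddGroupTopology G) (e : H ≃+ G) :
    HasNonarchPolishAddGroupTopology H := by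
  obtain ⟨t, hna, hP⟩ := h
  let _ : TopologicalSpace H := t.induced e
  have : IsTopologicalAddGroup H := topologicalAddGroup_induced e
  let f : H ≃ₜ G := e.toEquiv.toHomeomorphOfIsInducing ⟨rfl⟩
  exact ⟨inferInstance, NonarchimedeanAddGroup.nonarchimedean_of_emb e.symm.toAddMonoidHom
    f.symm.isOpenEmbedding, f.isClosedEmbedding.polishSpace⟩

namespace ZMod

variable {p k : ℕ} [NeZero p]

theorem castHom_pow_eq_zero_iff_dvd (hk : p ∣ p ^ k) (x : ZMod (p ^ k)) :
    castHom hk (ZMod p) x = 0 ↔ (p : ZMod (p ^ k)) ∣ x := by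
  obtain ⟨n, rfl⟩ := natCast_zmod_surjective x
  constructor
  · intro h
    rw [map_natCast, natCast_eq_zero_iff] at h
    exact Nat.cast_dvd_cast h
  · rintro ⟨y, hy⟩
    rw [hy, map_mul, map_natCast, natCast_self, zero_mul]

theorem dvd_of_pow_mul_eq_zero {j : ℕ} (hj : j < k) {x : ZMod (p ^ k)}
    (h : (p : ZMod (p ^ k)) ^ j * x = 0) : (p : ZMod (p ^ k)) ∣ x := by
  obtain ⟨n, rfl⟩ := natCast_zmod_surjective x
  rw [← Nat.cast_pow, ← Nat.cast_mul, natCast_eq_zero_iff] at h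
  obtain ⟨d, rfl⟩ := Nat.exists_eq_add_of_lt hj
  rw [add_assoc, pow_add] at h
  exact Nat.cast_dvd_cast ((dvd_pow_self p d.succ_ne_zero).trans
    (Nat.dvd_of_mul_dvd_mul_left (pow_pos (NeZero.pos p) j) h))

/-- A lift to `ZMod (p ^ k)` of a basis of `ℕ → ZMod p` spans freely. -/
theorem bijective_linearCombination_of_basis [Fact p.Prime] (hk : p ∣ p ^ k) {B : Type*}
    (b : Module.Basis B (ZMod p) (ℕ → ZMod p)) (v : B → ℕ → ZMod (p ^ k))
    (hv : ∀ i n, castHom hk (ZMod p) (v i n) = b i n) :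
    Function.Bijective (Finsupp.linearCombination (ZMod (p ^ k)) v) := by
  let π := castHom hk (ZMod p)
  have reduce (f : B →₀ ZMod (p ^ k)) (n : ℕ) :
      π (Finsupp.linearCombination (ZMod (p ^ k)) v f n) =
        Finsupp.linearCombination (ZMod p) b (f.mapRange π (map_zero π)) n := by
    rw [Finsupp.linearCombination_apply, Finsupp.linearCombination_apply,
      Finsupp.sum_mapRange_index (by simp), Finsupp.sum, Finsupp.sum]
    simp only [Finset.sum_apply, Pi.smul_apply, smul_eq_mul, map_sum, map_mul, ← hv]
    rfl
  have pow_eq_zero : (p : ZMod (p ^ k)) ^ k = 0 := by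
    rw [← Nat.cast_pow, natCast_self]
  constructor
  · rw [injective_iff_map_eq_zero]
    intro f hf
    have key : ∀ j ≤ k, ∃ g : B →₀ ZMod (p ^ k), f = (p : ZMod (p ^ k)) ^ j • g := by
      intro j
      induction j with
      | zero => exact fun _ => ⟨f, by simp⟩
      | succ j ih =>
        intro hj
        obtain ⟨g, rfl⟩ := ih (by omega)
        have hg : g.mapRange π (map_zero π) = 0 := by
          refine (injective_iff_map_eq_zero _).1 b.linearIndependent _ (funext fun n => ?_)
          rw [← reduce, Pi.zero_apply, castHom_pow_eq_zero_iff_dvd]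
          refine dvd_of_pow_mul_eq_zero hj ?_
          simpa using congrFun hf n
        have hdvd (i : B) : (p : ZMod (p ^ k)) ∣ g i :=
          (castHom_pow_eq_zero_iff_dvd hk _).1 (DFunLike.congr_fun hg i)
        choose c hc using hdvd
        classical
        refine ⟨Finsupp.onFinset g.support (fun i => if g i = 0 then 0 else c i)
          (fun i hi => by rw [Finsupp.mem_support_iff]; rintro h; simp [h] at hi), ?_⟩
        ext i
        by_cases h : g i = 0
        · simp [h]
        · simp [h, pow_succ, mul_assoc, ← hc]
    obtain ⟨g, rfl⟩ := key k le_rfl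
    rw [pow_eq_zero, zero_smul]
  · intro m
    have step (m : ℕ → ZMod (p ^ k)) : ∃ (f : B →₀ ZMod (p ^ k)) (m' : ℕ → ZMod (p ^ k)),
        m = Finsupp.linearCombination _ v f + (p : ZMod (p ^ k)) • m' := by
      obtain ⟨f, hf⟩ := Finsupp.mapRange_surjective π (map_zero π) (castHom_surjective hk)
        (b.repr fun n => π (m n))
      have hdvd (n : ℕ) :
          (p : ZMod (p ^ k)) ∣ m n - Finsupp.linearCombination (ZMod (p ^ k)) v f n := by
        rw [← castHom_pow_eq_zero_iff_dvd hk, map_sub, sub_eq_zero]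
        exact ((reduce f n).trans (by rw [hf, b.linearCombination_repr])).symm
      choose m' hm' using hdvd
      exact ⟨f, m', funext fun n => by simp [← hm']⟩
    have key (j : ℕ) : ∃ (f : B →₀ ZMod (p ^ k)) (m' : ℕ → ZMod (p ^ k)),
        m = Finsupp.linearCombination _ v f + (p : ZMod (p ^ k)) ^ j • m' := by
      induction j with
      | zero => exact ⟨0, m, by simp⟩
      | succ j ih =>
        obtain ⟨f, m', rfl⟩ := ih
        obtain ⟨g, m'', rfl⟩ := step m'
        exact ⟨f + (p : ZMod (p ^ k)) ^ j • g, m'', by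
          rw [map_add, map_smul, smul_add, smul_smul, pow_succ, add_assoc]⟩
    obtain ⟨f, m', rfl⟩ := key k
    exact ⟨f, by rw [pow_eq_zero, zero_smul, add_zero]⟩

end ZMod

/-- The direct sum of continuum many copies of `ℚ` admits a non-Archimedean Polish group
topology, and for every prime `p` and every `k ≥ 1` the direct sum of continuum many copies
of `ℤ/p^kℤ` admits a non-Archimedean Polish group topology. -/
theorem continuum_copies_nonarch_polish :
    HasNonarchPolishAddGroupTopology ((Cardinal.continuum).out →₀ ℚ) ∧
      ∀ p k : ℕ, p.Prime → 1 ≤ k →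
        HasNonarchPolishAddGroupTopology ((Cardinal.continuum).out →₀ ZMod (p ^ k)) := by
  constructor
  · let b := Module.Basis.ofVectorSpace ℚ (ℕ → ℚ)
    obtain ⟨e⟩ := nonempty_continuum_out_equiv_basis b
    exact (hasNonarchPolishAddGroupTopology_pi_nat ℚ).of_addEquiv
      ((Finsupp.domLCongr (R := ℚ) e).trans b.repr.symm).toAddEquiv
  · intro p k hp hk
    have : Fact p.Prime := ⟨hp⟩
    have hpk : p ∣ p ^ k := dvd_pow_self p (by omega)
    let b := Module.Basis.ofVectorSpace (ZMod p) (ℕ → ZMod p)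
    obtain ⟨e⟩ := nonempty_continuum_out_equiv_basis b
    choose v hv using fun i n => ZMod.castHom_surjective hpk (b i n)
    exact (hasNonarchPolishAddGroupTopology_pi_nat (ZMod (p ^ k))).of_addEquiv
      ((Finsupp.domLCongr (R := ZMod (p ^ k)) e).trans (LinearEquiv.ofBijective _
        (ZMod.bijective_linearCombination_of_basis hpk b v hv))).toAddEquiv
end
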